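/- Let K be a field of characteristic zero and let n ≥ 1. The standard action of the orthogonal group O(n, K) on the vector space Kⁿ is irreducible: if W ⊆ Kⁿ is a K-linear subspace such that A·w ∈ W for every n×n matrix A over K with Aᵀ·A = I and every w ∈ W, then W = 0 or W = Kⁿ. -/

import Mathlib

open Matrix

/-- The standard action of the orthogonal group `O(n, K)` (matrices `A` with
`Aᵀ * A = 1`) on `Kⁿ` is irreducible: any subspace stable under all orthogonal
matrices is `0` or everything. -/
theorem orthogonalGroup_irreducible
    (K : Type*) [Field K] [CharZero K] (n : ℕ) (hn : 1 ≤ n)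
    (W : Submodule K (Fin n → K))
    (hW : ∀ A : Matrix (Fin n) (Fin n) K, Aᵀ * A = 1 →
      ∀ w ∈ W, A.mulVec w ∈ W) :
    W = ⊥ ∨ W = ⊤ := by
  rw [or_iff_not_imp_left]
  intro hne
  obtain ⟨w, hw, hw0⟩ := W.exists_mem_ne_zero_of_ne_bot hne
  obtain ⟨i, hi⟩ := Function.ne_iff.mp hw0
  have hsingle : Pi.single i (1 : K) ∈ W := by
    have hrefl : (diagonal (Function.update (1 : Fin n → K) i (-1))) *ᵥ w ∈ W := by
      refine hW _ ?_ w hw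
      rw [diagonal_transpose, diagonal_mul_diagonal, ← diagonal_one]
      congr 1
      ext k
      by_cases hk : k = i <;> simp [hk]
    have key := W.smul_mem (2 * w i)⁻¹ (W.sub_mem hw hrefl)
    convert key using 1
    ext k
    by_cases hk : k = i
    · subst hk
      have hk0 : w k ≠ 0 := hi
      simp only [Pi.single_eq_same, Pi.smul_apply, Pi.sub_apply, mulVec_diagonal,
        Function.update_self, smul_eq_mul]
      field_simp
      ring
    · simp [mulVec_diagonal, hk]
  have hbasis (j : Fin n) : Pi.single j (1 : K) ∈ W := by
    have hswap := hW ((Equiv.swap i j).permMatrix K)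
      (by simp [← permMatrix_mul, transpose_permMatrix]) _ hsingle
    convert hswap using 1
    ext k
    simp [Pi.single_apply, Equiv.swap_apply_eq_iff]
  rw [eq_top_iff, ← (Pi.basisFun K (Fin n)).span_eq, Submodule.span_le]
  rintro _ ⟨j, rfl⟩
  simpa using hbasis j
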